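/- Let f : ℝ³ → ℝ be a smooth function supported in the open ball of radius R > 0 centered at the origin, and define the projections g(z, r) = r² ∫_{S²} f(z + r θ) dσ(θ). Let j₀(t) = sin t / t and n₀(t) = -cos t / t. Then for every z with |z| = R and every t ∈ (0, 2R): (2/π) ∫₀^∞ [ n₀(λ t) ( ∫₀^{2R} j₀(λ t′) g(z, t′) dt′ ) - j₀(λ t) ( ∫₀^{2R} n₀(λ t′) g(z, t′) dt′ ) ] λ³ dλ = -(2/t) · d/dt ( g(z, t)/t ), where the λ-integral is understood as the improper limit of integrals over [0, L] as L → ∞. -/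

import Mathlib

open MeasureTheory Real Filter

/-- The spherical Bessel function of order zero, `j₀(t) = sin t / t` (with `j₀(0) = 1`). -/
noncomputable def j0 (t : ℝ) : ℝ := if t = 0 then 1 else Real.sin t / t

/-- The spherical Neumann function of order zero, `n₀(t) = -cos t / t`. -/
noncomputable def n0 (t : ℝ) : ℝ := -Real.cos t / t

/-- The spherical mean Radon transform (projections) of `f : ℝ³ → ℝ`:
`g(z,r) = r² ∫_{S²} f(z + rθ) dσ(θ)`. -/
noncomputable def proj (f : EuclideanSpace ℝ (Fin 3) → ℝ)
    (z : EuclideanSpace ℝ (Fin 3)) (r : ℝ) : ℝ :=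
  r ^ 2 * ∫ θ in Metric.sphere (0 : EuclideanSpace ℝ (Fin 3)) 1, f (z + r • θ) ∂(μH[2])

theorem sphere_finite :
    (μH[2] : Measure (EuclideanSpace ℝ (Fin 3))) (Metric.sphere (0 : EuclideanSpace ℝ (Fin 3)) 1) < ⊤ := by
  set P : (Fin 2 → ℝ) → EuclideanSpace ℝ (Fin 3) := fun p =>
    !₂[Real.sin (p 0) * Real.cos (p 1), Real.sin (p 0) * Real.sin (p 1), Real.cos (p 0)] with hP
  have hPc : ContDiff ℝ 1 P := by
    rw [contDiff_euclidean]
    intro i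
    fin_cases i <;> simp [hP] <;> fun_prop
  set K : Set (Fin 2 → ℝ) := Set.Icc (fun _ => -π) (fun _ => π)
  have hK : IsCompact K := isCompact_Icc
  obtain ⟨C, hC⟩ := LocallyLipschitzOn.exists_lipschitzOnWith_of_compact hK
    (hPc.locallyLipschitz.locallyLipschitzOn (s := K))
  have hsub : Metric.sphere (0 : EuclideanSpace ℝ (Fin 3)) 1 ⊆ P '' K := by
    intro x hx
    have h1 : x 0 ^ 2 + x 1 ^ 2 + x 2 ^ 2 = 1 := by
      have : ‖x‖ = 1 := by simpa using hx
      have h2 := EuclideanSpace.norm_sq_eq x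
      rw [this, Fin.sum_univ_three] at h2
      simp only [Real.norm_eq_abs, sq_abs] at h2
      linarith
    have hx2 : -1 ≤ x 2 ∧ x 2 ≤ 1 := by
      constructor <;> nlinarith [sq_nonneg (x 0), sq_nonneg (x 1)]
    set w : ℂ := ⟨x 0, x 1⟩
    have hw : ‖w‖ = Real.sin (Real.arccos (x 2)) := by
      rw [Real.sin_arccos, Complex.norm_def, Complex.normSq_apply]
      congr 1
      simp only [w]; linarith
    refine ⟨![Real.arccos (x 2), Complex.arg w], ?_, ?_⟩
    · constructor
      · intro i
        fin_cases i
        · simpa using (by linarith [Real.arccos_nonneg (x 2), Real.pi_pos] : -π ≤ Real.arccos (x 2))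
        · simpa using (Complex.neg_pi_lt_arg w).le
      · intro i
        fin_cases i
        · simpa using Real.arccos_le_pi (x 2)
        · simpa using Complex.arg_le_pi w
    · ext i
      fin_cases i
      · simp [hP, ← hw, Complex.norm_mul_cos_arg, w]
      · simp [hP, ← hw, Complex.norm_mul_sin_arg, w]
      · simp [hP, Real.cos_arccos hx2.1 hx2.2]
  refine (measure_mono hsub).trans_lt ((hC.hausdorffMeasure_image_le (by norm_num)).trans_lt ?_)
  refine ENNReal.mul_lt_top (ENNReal.rpow_lt_top_of_nonneg (by norm_num) (by simp)) ?_
  have := hausdorffMeasure_pi_real (ι := Fin 2)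
  simp only [Fintype.card_fin, Nat.cast_ofNat] at this
  rw [this]
  exact hK.measure_lt_top

theorem param_deriv (Φ : ℝ × EuclideanSpace ℝ (Fin 3) → ℝ) (hΦ : ContDiff ℝ (⊤ : ℕ∞) Φ) (s : ℝ) :
    HasDerivAt (fun s => ∫ θ in Metric.sphere (0 : EuclideanSpace ℝ (Fin 3)) 1, Φ (s, θ) ∂(μH[2]))
      (∫ θ in Metric.sphere (0 : EuclideanSpace ℝ (Fin 3)) 1, fderiv ℝ Φ (s, θ) (1, 0) ∂(μH[2])) s := by
  have : IsFiniteMeasure ((μH[2] : Measure (EuclideanSpace ℝ (Fin 3))).restrict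
      (Metric.sphere (0 : EuclideanSpace ℝ (Fin 3)) 1)) :=
    ⟨by simpa using sphere_finite⟩
  have hc' : Continuous (fun p : ℝ × EuclideanSpace ℝ (Fin 3) => fderiv ℝ Φ p (1, 0)) :=
    (hΦ.continuous_fderiv (by simp)).clm_apply continuous_const
  have hS : IsCompact (Metric.sphere (0 : EuclideanSpace ℝ (Fin 3)) 1) := isCompact_sphere _ _
  obtain ⟨C, hC⟩ := ((isCompact_Icc (a := s - 1) (b := s + 1)).prod hS).exists_bound_of_continuousOn
    hc'.continuousOn
  obtain ⟨D, hD⟩ := hS.exists_bound_of_continuousOn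
    (f := fun θ => Φ (s, θ)) (hΦ.continuous.comp (by fun_prop)).continuousOn
  have hae : ∀ᵐ θ ∂((μH[2] : Measure (EuclideanSpace ℝ (Fin 3))).restrict
      (Metric.sphere (0 : EuclideanSpace ℝ (Fin 3)) 1)), θ ∈ Metric.sphere (0 : EuclideanSpace ℝ (Fin 3)) 1 :=
    ae_restrict_mem hS.isClosed.measurableSet
  refine (hasDerivAt_integral_of_dominated_loc_of_deriv_le
    (F := fun s θ => Φ (s, θ)) (F' := fun s θ => fderiv ℝ Φ (s, θ) (1, 0))
    (s := Set.Icc (s - 1) (s + 1)) (bound := fun _ => C)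
    (Icc_mem_nhds (by linarith) (by linarith)) ?_ ?_ ?_ ?_ (integrable_const C) ?_).2
  · exact Eventually.of_forall fun x =>
      (hΦ.continuous.comp (by fun_prop : Continuous fun θ => (x, θ))).aestronglyMeasurable
  · refine Integrable.of_bound
      (hΦ.continuous.comp (by fun_prop : Continuous fun θ => (s, θ))).aestronglyMeasurable D ?_
    filter_upwards [hae] with θ hθ using hD θ hθ
  · exact (hc'.comp (by fun_prop : Continuous fun θ => (s, θ))).aestronglyMeasurable
  · filter_upwards [hae] with θ hθ x hx using hC (x, θ) ⟨hx, hθ⟩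
  · refine Eventually.of_forall fun θ x _ => ?_
    have h1 : HasFDerivAt Φ (fderiv ℝ Φ (x, θ)) (x, θ) :=
      (hΦ.differentiable (by simp) _).hasFDerivAt
    have h2 : HasDerivAt (fun y : ℝ => (y, θ)) ((1 : ℝ), (0 : EuclideanSpace ℝ (Fin 3))) x :=
      (hasDerivAt_id x).prodMk (hasDerivAt_const x θ)
    exact h1.comp_hasDerivAt x h2

/-- The spherical mean has two derivatives. -/
theorem mean_derivs (f : EuclideanSpace ℝ (Fin 3) → ℝ) (hf : ContDiff ℝ (⊤ : ℕ∞) f)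
    (z : EuclideanSpace ℝ (Fin 3)) : ∃ M1 M2 : ℝ → ℝ,
    (∀ s, HasDerivAt (fun s : ℝ => ∫ θ in Metric.sphere (0 : EuclideanSpace ℝ (Fin 3)) 1,
      f (z + s • θ) ∂(μH[2])) (M1 s) s) ∧ ∀ s, HasDerivAt M1 (M2 s) s := by
  have hΦ : ContDiff ℝ (⊤ : ℕ∞) (fun p : ℝ × EuclideanSpace ℝ (Fin 3) => f (z + p.1 • p.2)) :=
    hf.comp (by fun_prop)
  have hΦ1 : ContDiff ℝ (⊤ : ℕ∞) (fun q : ℝ × EuclideanSpace ℝ (Fin 3) =>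
      fderiv ℝ (fun p : ℝ × EuclideanSpace ℝ (Fin 3) => f (z + p.1 • p.2)) q (1, 0)) :=
    (hΦ.fderiv_right (by simp)).clm_apply contDiff_const
  exact ⟨_, _, fun s => param_deriv _ hΦ s, fun s => param_deriv _ hΦ1 s⟩

theorem rl_sin (ψ : ℝ → ℝ) (hψ : Integrable ψ) :
    Tendsto (fun L : ℝ => ∫ u, Real.sin (L * u) * ψ u) atTop (nhds 0) := by
  have h := (Real.tendsto_integral_exp_smul_cocompact (fun u => (ψ u : ℂ))).mono_left
    (atTop_le_cocompact (α := ℝ))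
  have h2 : Tendsto (fun L : ℝ => L / (2 * π)) atTop atTop :=
    tendsto_id.atTop_div_const (by positivity)
  have h3 := (Complex.continuous_im.tendsto 0).comp (h.comp h2)
  have h4 := h3.neg
  simp only [Complex.zero_im, neg_zero] at h4
  refine h4.congr fun L => ?_
  simp only [Function.comp]
  have hψc : Integrable (fun u => (ψ u : ℂ)) := hψ.ofReal
  have hint : Integrable (fun v : ℝ => Real.fourierChar (-(v * (L / (2 * π)))) • (ψ v : ℂ)) := by
    refine hψc.norm.mono' ?_ ?_
    · refine AEStronglyMeasurable.smul ?_ hψc.aestronglyMeasurable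
      exact (continuous_subtype_val.comp (Real.continuous_fourierChar.comp
        (by fun_prop : Continuous fun v : ℝ => -(v * (L / (2 * π)))))).aestronglyMeasurable
    · exact Eventually.of_forall fun v => by simp
  have h5 := integral_im hint
  simp only [RCLike.im_eq_complex_im] at h5
  rw [← h5, ← integral_neg]
  congr 1
  ext u
  rw [Circle.smul_def, Real.fourierChar_apply, smul_eq_mul, Complex.im_mul_ofReal]
  rw [Complex.exp_ofReal_mul_I_im]
  rw [show 2 * π * -(u * (L / (2 * π))) = -(L * u) by field_simp]
  rw [Real.sin_neg]; ring

theorem gauss_cos (l : ℝ) : ∫ u : ℝ, Real.cos (l * u) * Real.exp (-1 * u ^ 2) =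
    √π * Real.exp (-(1 / 4) * l ^ 2) := by
  have h := fourierIntegral_gaussian (b := 1) (by simp) (l : ℂ)
  have hint : Integrable (fun x : ℝ => Complex.exp (Complex.I * l * x) * Complex.exp (-1 * (x : ℂ) ^ 2)) := by
    refine (integrable_exp_neg_mul_sq (b := 1) one_pos).mono' ?_ ?_
    · exact Continuous.aestronglyMeasurable (by fun_prop)
    · refine Eventually.of_forall fun x => ?_
      rw [norm_mul, Complex.norm_exp, Complex.norm_exp]
      norm_cast
      simp
  have h5 := integral_re hint
  rw [h] at h5
  simp only [RCLike.re_eq_complex_re] at h5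
  have e1 : (fun x : ℝ => (Complex.exp (Complex.I * l * x) * Complex.exp (-1 * (x : ℂ) ^ 2)).re) =
      fun u : ℝ => Real.cos (l * u) * Real.exp (-1 * u ^ 2) := by
    ext x
    rw [show (-1 * (x : ℂ) ^ 2) = ((-1 * x ^ 2 : ℝ) : ℂ) by push_cast; ring, ← Complex.ofReal_exp,
      Complex.re_mul_ofReal, show Complex.I * l * x = ((l * x : ℝ) : ℂ) * Complex.I by push_cast; ring,
      Complex.exp_ofReal_mul_I_re]
  rw [e1] at h5
  rw [h5]
  rw [show (-(l : ℂ) ^ 2 / (4 * 1)) = ((-(1 / 4) * l ^ 2 : ℝ) : ℂ) by push_cast; ring,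
    ← Complex.ofReal_exp, Complex.re_mul_ofReal]
  congr 1
  rw [div_one, show (1 / 2 : ℂ) = ((1 / 2 : ℝ) : ℂ) by push_cast; ring,
    ← Complex.ofReal_cpow Real.pi_pos.le, Complex.ofReal_re, Real.sqrt_eq_rpow]

theorem gauss_limit : Tendsto (fun L : ℝ => ∫ l in (0:ℝ)..L,
    ∫ u : ℝ, Real.cos (l * u) * Real.exp (-1 * u ^ 2)) atTop (nhds π) := by
  simp_rw [gauss_cos]
  have h := intervalIntegral_tendsto_integral_Ioi (μ := volume)
    (f := fun l : ℝ => √π * Real.exp (-(1 / 4) * l ^ 2)) 0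
    (((integrable_exp_neg_mul_sq (b := 1 / 4) (by norm_num)).const_mul _).integrableOn) tendsto_id
  rw [integral_const_mul, integral_gaussian_Ioi] at h
  have e : √π * (√(π / (1 / 4)) / 2) = π := by
    rw [show π / (1 / 4) = 2 ^ 2 * π by ring, Real.sqrt_mul (by norm_num), Real.sqrt_sq (by norm_num)]
    have := Real.mul_self_sqrt Real.pi_pos.le
    linarith
  rwa [e] at h

theorem fubini_cos (ψ w : ℝ → ℝ) (hw : Integrable w) (h : ∀ u, w u = u * ψ u) (h0 : ψ 0 = 0) (L : ℝ) :
    ∫ l in (0:ℝ)..L, ∫ u : ℝ, Real.cos (l * u) * w u = ∫ u, Real.sin (L * u) * ψ u := by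
  rw [intervalIntegral_integral_swap]
  · congr 1
    ext u
    rw [intervalIntegral.integral_mul_const]
    by_cases hu : u = 0
    · subst hu; simp [h, h0]
    · rw [intervalIntegral.integral_comp_mul_right (fun x => Real.cos x) hu, integral_cos, h]
      simp; field_simp
  · have h1 : Integrable (fun p : ℝ × ℝ => (1 : ℝ) * w p.2)
        ((volume.restrict (Set.uIoc 0 L)).prod volume) := by
      have : Integrable (fun _ : ℝ => (1:ℝ)) (volume.restrict (Set.uIoc 0 L)) :=
        (intervalIntegrable_iff.1 (intervalIntegrable_const (a := 0) (b := L)))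
      exact this.mul_prod hw
    refine h1.mono ?_ ?_
    · exact (Continuous.aestronglyMeasurable (by fun_prop)).mul
        (by simpa using h1.aestronglyMeasurable)
    · refine Eventually.of_forall fun p => ?_
      simp only [Function.uncurry, norm_mul, one_mul]
      exact mul_le_of_le_one_left (norm_nonneg _) (Real.abs_cos_le_one _)

theorem div_integrable (v : ℝ → ℝ) (hv : Integrable v) (h0 : v 0 = 0) (hd : DifferentiableAt ℝ v 0) :
    Integrable (fun u => v u / u) := by
  have hO := hd.isBigO_sub
  simp only [h0, sub_zero] at hO
  obtain ⟨C, hC⟩ := hO.bound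
  obtain ⟨δ, hδ, hball⟩ := Metric.eventually_nhds_iff.1 hC
  have hm : AEStronglyMeasurable (fun u => v u / u) volume :=
    (hv.aemeasurable.div aemeasurable_id).aestronglyMeasurable
  have hg : Integrable (fun u => (Metric.ball (0:ℝ) δ).indicator (fun _ => |C|) u + |v u| / δ) := by
    refine Integrable.add ?_ (hv.abs.div_const _)
    rw [integrable_indicator_iff Metric.isOpen_ball.measurableSet]
    exact integrableOn_const measure_ball_lt_top.ne
  refine hg.mono' hm (Eventually.of_forall fun u => ?_)
  by_cases hu : u ∈ Metric.ball (0:ℝ) δ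
  · rw [Set.indicator_of_mem hu]
    have h1 := hball hu
    have : ‖v u / u‖ ≤ |C| := by
      rw [norm_div]
      refine div_le_of_le_mul₀ (norm_nonneg _) (abs_nonneg _) (h1.trans ?_)
      gcongr
      exact le_abs_self C
    have : 0 ≤ |v u| / δ := by positivity
    linarith
  · rw [Set.indicator_of_notMem hu]
    simp only [Metric.mem_ball, dist_zero_right, not_lt] at hu
    rw [norm_div, zero_add]
    exact div_le_div_of_nonneg_left (abs_nonneg _) hδ hu

theorem core (w : ℝ → ℝ) (hw : Integrable w) (hd : DifferentiableAt ℝ w 0) :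
    Tendsto (fun L : ℝ => ∫ l in (0:ℝ)..L, ∫ u : ℝ, Real.cos (l * u) * w u) atTop
      (nhds (π * w 0)) := by
  have hgi : Integrable (fun u : ℝ => Real.exp (-1 * u ^ 2)) := integrable_exp_neg_mul_sq one_pos
  set v : ℝ → ℝ := fun u => w u - w 0 * Real.exp (-1 * u ^ 2) with hv
  have hvi : Integrable v := hw.sub (hgi.const_mul _)
  have hv0 : v 0 = 0 := by simp [hv]
  have hvd : DifferentiableAt ℝ v 0 := hd.sub (by fun_prop)
  have hψ := div_integrable v hvi hv0 hvd
  have h1 := rl_sin _ hψ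
  have h2 := (h1.add (gauss_limit.const_mul (w 0)))
  rw [zero_add, mul_comm] at h2
  refine h2.congr fun L => ?_
  rw [← fubini_cos (fun u => v u / u) v hvi (fun u => by
    by_cases hu : u = 0
    · subst hu; simp [hv0]
    · field_simp) (by simp) L]
  have hcos : ∀ (q : ℝ → ℝ), Integrable q → ∀ l : ℝ, Integrable (fun u => Real.cos (l * u) * q u) := by
    intro q hq l
    refine hq.mono ((Continuous.aestronglyMeasurable (by fun_prop)).mul hq.aestronglyMeasurable) ?_
    refine Eventually.of_forall fun u => ?_
    rw [norm_mul]
    exact mul_le_of_le_one_left (norm_nonneg _) (Real.abs_cos_le_one _)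
  have hcont : ∀ (q : ℝ → ℝ), Integrable q → Continuous (fun l : ℝ => ∫ u, Real.cos (l * u) * q u) := by
    intro q hq
    refine continuous_of_dominated (bound := fun u => ‖q u‖) (fun l => (hcos q hq l).aestronglyMeasurable)
      (fun l => Eventually.of_forall fun u => ?_) hq.norm (Eventually.of_forall fun u => by fun_prop)
    rw [norm_mul]
    exact mul_le_of_le_one_left (norm_nonneg _) (Real.abs_cos_le_one _)
  rw [← intervalIntegral.integral_const_mul, ← intervalIntegral.integral_add
    ((hcont v hvi).intervalIntegrable _ _) (((hcont _ hgi).const_mul _).intervalIntegrable _ _)]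
  congr 1
  ext l
  rw [← integral_const_mul, ← integral_add (hcos v hvi l) ((hcos _ hgi l).const_mul _)]
  congr 1
  ext u
  simp only [hv]; ring

/-- The spectral filtration of the 3-D inversion formula reduces to a single
differentiation of the data: for `z` on the measurement sphere and `t ∈ (0, 2R)`,
`(2/π) ∫₀^∞ [ n₀(λt) ∫₀^{2R} j₀(λt')g(z,t')dt' - j₀(λt) ∫₀^{2R} n₀(λt')g(z,t')dt' ] λ³ dλ
  = -(2/t) d/dt (g(z,t)/t)`,
the `λ`-integral being the improper limit over `[0,L]` as `L → ∞`. -/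
theorem filtration_reduces_to_derivative_3d
    (R : ℝ) (hR : 0 < R)
    (f : EuclideanSpace ℝ (Fin 3) → ℝ) (hf : ContDiff ℝ (⊤ : ℕ∞) f)
    (hsupp : Function.support f ⊆ Metric.ball (0 : EuclideanSpace ℝ (Fin 3)) R)
    (z : EuclideanSpace ℝ (Fin 3)) (hz : ‖z‖ = R)
    (t : ℝ) (ht : t ∈ Set.Ioo (0 : ℝ) (2 * R)) :
    Tendsto
      (fun L : ℝ =>
        (2 / π) * ∫ lam in (0:ℝ)..L,
          (n0 (lam * t) * (∫ t' in (0:ℝ)..(2 * R), j0 (lam * t') * proj f z t')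
            - j0 (lam * t) * (∫ t' in (0:ℝ)..(2 * R), n0 (lam * t') * proj f z t'))
            * lam ^ 3)
      atTop (nhds (-(2 / t) * deriv (fun s : ℝ => proj f z s / s) t)) := by
  obtain ⟨ht0, htb⟩ := ht
  set M : ℝ → ℝ := fun s : ℝ => ∫ θ in Metric.sphere (0 : EuclideanSpace ℝ (Fin 3)) 1,
      f (z + s • θ) ∂(μH[2]) with hM
  obtain ⟨M1, M2, hM1, hM2⟩ := mean_derivs f hf z
  have hproj : ∀ s, proj f z s = s * (s * M s) := fun s => by
    simp only [proj, hM]; ring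
  set h : ℝ → ℝ := fun s => s * M s with hh
  set h1 : ℝ → ℝ := fun s => M s + s * M1 s with hh1
  have hd : ∀ s, HasDerivAt h (h1 s) s := fun s => by
    have h2 : HasDerivAt h (1 * M s + s * M1 s) s := (hasDerivAt_id s).mul (hM1 s)
    rwa [one_mul] at h2
  have hd1 : ∀ s, DifferentiableAt ℝ h1 s := fun s =>
    (hM1 s).differentiableAt.add (differentiableAt_id.mul (hM2 s).differentiableAt)
  have hc1 : Continuous h1 := continuous_iff_continuousAt.2 fun s => (hd1 s).continuousAt
  have hc : Continuous h := continuous_iff_continuousAt.2 fun s => (hd s).continuousAt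
  have hderiv : deriv (fun s : ℝ => proj f z s / s) t = h1 t := by
    have e : (fun s : ℝ => proj f z s / s) = h := by
      ext s
      rw [hproj]
      by_cases hs : s = 0
      · subst hs; simp [hh]
      · field_simp; rfl
    rw [e, (hd t).deriv]
  have h0 : h 0 = 0 := by simp [hh]
  have hb : h (2 * R) = 0 := by
    have : M (2 * R) = 0 := by
      simp only [hM]
      refine setIntegral_eq_zero_of_forall_eq_zero fun θ hθ => ?_
      by_contra hne
      have h2 := hsupp (Function.mem_support.2 hne)
      rw [mem_ball_zero_iff] at h2
      have h3 : ‖θ‖ = 1 := by simpa using hθ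
      have h4 : ‖(2 * R) • θ‖ = 2 * R := by
        rw [norm_smul, h3, Real.norm_of_nonneg (by linarith), mul_one]
      have h5 := norm_sub_norm_le ((2 * R) • θ) (-z)
      rw [norm_neg, h4, hz, sub_neg_eq_add, add_comm _ z] at h5
      linarith
    simp [hh, this]
  set w : ℝ → ℝ := fun u => (Set.Ioc 0 (2 * R)).indicator h1 (u + t) with hw
  have hI : Integrable ((Set.Ioc 0 (2 * R)).indicator h1) := by
    rw [integrable_indicator_iff measurableSet_Ioc]
    exact hc1.integrableOn_Ioc
  have hwi : Integrable w := hI.comp_add_right t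
  have hw0 : w 0 = h1 t := by
    simp only [hw, zero_add]
    exact Set.indicator_of_mem (Set.mem_Ioc.2 ⟨ht0, htb.le⟩) _
  have hwd : DifferentiableAt ℝ w 0 := by
    have h2 : DifferentiableAt ℝ (fun u => h1 (u + t)) 0 :=
      (hd1 (0 + t)).comp (f := fun u => u + t) 0 (by fun_prop)
    refine h2.congr_of_eventuallyEq ?_
    have : ∀ᶠ u : ℝ in nhds 0, u + t ∈ Set.Ioo 0 (2 * R) := by
      refine ContinuousAt.eventually_mem (f := fun u : ℝ => u + t) (by fun_prop) ?_
      simpa using Ioo_mem_nhds ht0 htb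
    filter_upwards [this] with u hu
    exact Set.indicator_of_mem (Set.Ioo_subset_Ioc_self hu) _
  have hcore := (core w hwi hwd).const_mul (2 / π * (-(1 / t)))
  rw [hderiv]
  have e1 : 2 / π * (-(1 / t)) * (π * w 0) = -(2 / t) * h1 t := by
    rw [hw0]; field_simp
  rw [e1] at hcore
  refine hcore.congr' ?_
  filter_upwards [eventually_ge_atTop 0] with L hL
  rw [mul_assoc, ← intervalIntegral.integral_const_mul]
  congr 1
  refine intervalIntegral.integral_congr_ae (Eventually.of_forall fun l hl => ?_)
  rw [Set.uIoc_of_le hL] at hl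
  have hl0 : 0 < l := hl.1
  have e2 : ∫ u, Real.cos (l * u) * w u = ∫ x in (0:ℝ)..(2 * R), Real.cos (l * (x - t)) * h1 x := by
    have := integral_add_right_eq_self (μ := (volume : Measure ℝ))
      (fun x => Real.cos (l * (x - t)) * (Set.Ioc 0 (2 * R)).indicator h1 x) t
    simp only [add_sub_cancel_right] at this
    rw [this, intervalIntegral.integral_of_le (by linarith), ← integral_indicator measurableSet_Ioc]
    congr 1
    ext x
    by_cases hx : x ∈ Set.Ioc 0 (2 * R)
    · simp [Set.indicator_of_mem hx]
    · simp [Set.indicator_of_notMem hx]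
  have e3 : ∫ x in (0:ℝ)..(2 * R), Real.cos (l * (x - t)) * h1 x =
      - ∫ x in (0:ℝ)..(2 * R), (-(l * Real.sin (l * (x - t)))) * h x := by
    rw [intervalIntegral.integral_mul_deriv_eq_deriv_mul (u := fun x => Real.cos (l * (x - t)))
      (u' := fun x => -(l * Real.sin (l * (x - t)))) (v := h) (v' := h1)]
    · rw [h0, hb]; ring
    · intro x _
      have h2 : HasDerivAt (fun x : ℝ => l * (x - t)) (l * 1) x :=
        ((hasDerivAt_id x).sub_const t).const_mul l
      have h3 := h2.cos
      rw [show -Real.sin (l * (x - t)) * (l * 1) = -(l * Real.sin (l * (x - t))) by ring] at h3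
      exact h3
    · exact fun x _ => hd x
    · exact Continuous.intervalIntegrable (by fun_prop) _ _
    · exact hc1.intervalIntegrable _ _
  have eA : ∫ t' in (0:ℝ)..(2 * R), j0 (l * t') * proj f z t' =
      (1 / l) * ∫ x in (0:ℝ)..(2 * R), Real.sin (l * x) * h x := by
    rw [← intervalIntegral.integral_const_mul]
    congr 1
    ext x
    rw [hproj]
    by_cases hx : x = 0
    · subst hx; simp
    · rw [j0, if_neg (mul_ne_zero hl0.ne' hx)]
      simp only [hh]; field_simp
  have eB : ∫ t' in (0:ℝ)..(2 * R), n0 (l * t') * proj f z t' =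
      (-(1 / l)) * ∫ x in (0:ℝ)..(2 * R), Real.cos (l * x) * h x := by
    rw [← intervalIntegral.integral_const_mul]
    congr 1
    ext x
    rw [hproj]
    by_cases hx : x = 0
    · subst hx; simp [h0]
    · rw [n0]
      simp only [hh]; field_simp
  have e4 : ∫ x in (0:ℝ)..(2 * R), (-(l * Real.sin (l * (x - t)))) * h x =
      (-(l * Real.cos (l * t))) * (∫ x in (0:ℝ)..(2 * R), Real.sin (l * x) * h x) +
      (l * Real.sin (l * t)) * ∫ x in (0:ℝ)..(2 * R), Real.cos (l * x) * h x := by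
    rw [← intervalIntegral.integral_const_mul, ← intervalIntegral.integral_const_mul,
      ← intervalIntegral.integral_add]
    · congr 1
      ext x
      rw [mul_sub, Real.sin_sub]; ring
    · exact Continuous.intervalIntegrable (by fun_prop) _ _
    · exact Continuous.intervalIntegrable (by fun_prop) _ _
  rw [e2, e3, e4, eA, eB, j0, if_neg (mul_ne_zero hl0.ne' ht0.ne'), n0]
  field_simp
  ring
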